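/- arXiv:2305.15838 — 4 statements merged into one kernel-verified Lean document; each statement's English description precedes it below -/
import Mathlib

section
/- Let m ≥ 2, E = ℝ^m, Cl the real Clifford algebra of Q(x) = -‖x‖², and let E_0 : E \ {0} → Cl be the Clifford–Cauchy kernel E_0(x) = -(1/σ_m) ‖x‖^{-m} • ι(x), where σ_m is the surface area of the unit sphere in ℝ^m. Then E_0 is left monogenic away from the origin: for every x ≠ 0, ∑_{i=1}^m ι(e_i) · ∂_{x_i} E_0(x) = 0. -/
open MeasureTheory

/-- Away from the origin the Euclidean norm has derivative `v ↦ ‖x‖⁻¹ ⟪x, v⟫`. -/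
theorem hasFDerivAt_norm_of_ne_zero {E : Type*} [NormedAddCommGroup E] [InnerProductSpace ℝ E]
    {x : E} (hx : x ≠ 0) :
    HasFDerivAt (fun u : E => ‖u‖) (‖x‖⁻¹ • innerSL ℝ x) x := by
  have hx' : ‖x‖ ≠ 0 := norm_ne_zero_iff.mpr hx
  have h := (hasStrictFDerivAt_norm_sq x).hasFDerivAt.sqrt (pow_ne_zero 2 hx')
  simp only [Real.sqrt_sq (norm_nonneg _)] at h
  convert h using 1
  ext v
  simp only [smul_apply, innerSL_apply_apply, smul_eq_mul, nsmul_eq_mul]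
  field_simp
  simp

/-- If a linear map `L` from `ℝᵐ` to a real algebra satisfies `L v * L v = -‖v‖²`, then
`u ↦ c ‖u‖⁻ᵐ • L u` is annihilated by the Dirac operator `∑ i, L eᵢ ∂ᵢ` away from the origin. -/
theorem sum_mul_fderiv_norm_pow_inv_smul_eq_zero {m : ℕ} {A : Type*} [NormedRing A]
    [NormedAlgebra ℝ A] (L : EuclideanSpace ℝ (Fin m) →L[ℝ] A)
    (hL : ∀ v, L v * L v = algebraMap ℝ A (-‖v‖ ^ 2)) (c : ℝ)
    {x : EuclideanSpace ℝ (Fin m)} (hx : x ≠ 0) :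
    ∑ i : Fin m, L (EuclideanSpace.single i 1) *
      fderiv ℝ (fun u => (c * (‖u‖ ^ m)⁻¹) • L u) x (EuclideanSpace.single i 1) = 0 := by
  have hx' : ‖x‖ ≠ 0 := norm_ne_zero_iff.mpr hx
  have hradial : HasFDerivAt (fun u : EuclideanSpace ℝ (Fin m) => c * (‖u‖ ^ m)⁻¹)
      ((-(c * m * (‖x‖ ^ (m + 2))⁻¹)) • innerSL ℝ x) x := by
    have hpow : HasDerivAt (fun t : ℝ => c * (t ^ m)⁻¹)
        (c * (-(m * ‖x‖ ^ (m - 1)) / (‖x‖ ^ m) ^ 2)) ‖x‖ :=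
      ((hasDerivAt_pow m ‖x‖).fun_inv (pow_ne_zero m hx')).const_mul c
    refine (hpow.comp_hasFDerivAt x (hasFDerivAt_norm_of_ne_zero hx)).congr_fderiv ?_
    rw [smul_smul]
    congr 1
    rcases m with _ | n
    · simp
    · simp only [Nat.add_sub_cancel]
      field_simp
      ring
  have hcoord : ∑ i, x i • L (EuclideanSpace.single i 1) = L x := by
    conv_rhs => rw [← (EuclideanSpace.basisFun (Fin m) ℝ).sum_repr x]
    simp [map_sum]
  have hterm (i : Fin m) : L (EuclideanSpace.single i 1) *
      fderiv ℝ (fun u => (c * (‖u‖ ^ m)⁻¹) • L u) x (EuclideanSpace.single i 1) =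
      algebraMap ℝ A (-(c * (‖x‖ ^ m)⁻¹)) +
        (-(c * m * (‖x‖ ^ (m + 2))⁻¹)) • (x i • L (EuclideanSpace.single i 1) * L x) := by
    rw [(hradial.fun_smul L.hasFDerivAt).fderiv]
    simp [mul_add, hL, Algebra.algebraMap_eq_smul_one, smul_smul, EuclideanSpace.inner_single_right]
  rw [Finset.sum_congr rfl fun i _ => hterm i, Finset.sum_add_distrib, ← Finset.smul_sum,
    ← Finset.sum_mul, hcoord, hL]
  simp only [Finset.sum_const, Finset.card_univ, Fintype.card_fin, Algebra.algebraMap_eq_smul_one,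
    smul_smul, ← Nat.cast_smul_eq_nsmul ℝ, ← add_smul]
  convert zero_smul ℝ (1 : A)
  field_simp
  ring

/-- The Clifford–Cauchy kernel `E₀(x) = -(1/σ_m) ‖x‖⁻ᵐ • ι(x)` is left monogenic away
from the origin: `∑ i ι(eᵢ) · ∂_{x_i} E₀(x) = 0` for `x ≠ 0`. Here `σ_m` is the surface
area ((m-1)-dimensional Hausdorff measure) of the unit sphere in `ℝ^m`. -/
theorem cliffordCauchyKernel_left_monogenic
    (m : ℕ) (hm : 2 ≤ m)
    (Q : QuadraticForm ℝ (EuclideanSpace ℝ (Fin m)))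
    (hQ : ∀ x : EuclideanSpace ℝ (Fin m), Q x = -‖x‖ ^ 2)
    {Cl : Type*} [NormedRing Cl] [NormedAlgebra ℝ Cl]
    (φ : CliffordAlgebra Q ≃ₐ[ℝ] Cl)
    (σm : ℝ)
    (hσm : σm = (μH[((m : ℝ) - 1)] (Metric.sphere (0 : EuclideanSpace ℝ (Fin m)) 1)).toReal)
    (E₀ : EuclideanSpace ℝ (Fin m) → Cl)
    (hE₀ : ∀ u : EuclideanSpace ℝ (Fin m),
      E₀ u = (-(σm⁻¹ * (‖u‖ ^ m)⁻¹)) • φ (CliffordAlgebra.ι Q u))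
    (x : EuclideanSpace ℝ (Fin m)) (hx : x ≠ 0) :
    (∑ i : Fin m, φ (CliffordAlgebra.ι Q (EuclideanSpace.single i (1 : ℝ))) *
        fderiv ℝ E₀ x (EuclideanSpace.single i (1 : ℝ))) = 0 := by
  let L : EuclideanSpace ℝ (Fin m) →L[ℝ] Cl :=
    LinearMap.toContinuousLinearMap (φ.toLinearMap ∘ₗ CliffordAlgebra.ι Q)
  have hL (v) : L v * L v = algebraMap ℝ Cl (-‖v‖ ^ 2) := by
    change φ (CliffordAlgebra.ι Q v) * φ (CliffordAlgebra.ι Q v) = _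
    rw [← map_mul, CliffordAlgebra.ι_sq_scalar, hQ, AlgEquiv.commutes]
  have hE : E₀ = fun u => (-σm⁻¹ * (‖u‖ ^ m)⁻¹) • L u := by
    funext u
    rw [hE₀, neg_mul]
    rfl
  rw [hE]
  exact sum_mul_fderiv_norm_pow_inv_smul_eq_zero L hL (-σm⁻¹) hx
end

section
/- Let m ≥ 2, E = ℝ^m, Cl the real Clifford algebra of Q(x) = -‖x‖², and let E_0 : E \ {0} → Cl be the Clifford–Cauchy kernel E_0(x) = -(1/σ_m) ‖x‖^{-m} • ι(x), where σ_m is the surface area of the unit sphere in ℝ^m. Then E_0 is right monogenic away from the origin: for every x ≠ 0, ∑_{i=1}^m ∂_{x_i} E_0(x) · ι(e_i) = 0. -/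
open MeasureTheory

/-- The derivative of `u ↦ ‖u‖⁻ᵐ` away from the origin. -/
theorem hasFDerivAt_inv_norm_pow {E : Type*} [NormedAddCommGroup E] [InnerProductSpace ℝ E]
    {m : ℕ} (hm : 2 ≤ m) {x : E} (hx : x ≠ 0) :
    HasFDerivAt (fun u : E => (‖u‖ ^ m)⁻¹)
      ((-(m * (‖x‖ ^ m)⁻¹ * (‖x‖ ^ 2)⁻¹)) • innerSL ℝ x) x := by
  have hx' : ‖x‖ ≠ 0 := norm_ne_zero_iff.mpr hx
  have hm' : (1 : ℝ) < m := by exact_mod_cast hm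
  have h := hasFDerivAt_norm_rpow x hm'
  have hsub : ‖x‖ ^ ((m : ℝ) - 2) = ‖x‖ ^ m / ‖x‖ ^ 2 := by
    rw [Real.rpow_sub (norm_pos_iff.mpr hx)]
    norm_cast
  simp only [hsub, Real.rpow_natCast] at h
  refine ((hasDerivAt_inv (pow_ne_zero m hx')).comp_hasFDerivAt x h).congr_fderiv ?_
  rw [smul_smul]
  congr 1
  field_simp

/-- The derivative at `x ≠ 0` of the vector field `u ↦ ‖u‖⁻ᵐ • L u`, for `L` linear. -/
theorem hasFDerivAt_inv_norm_pow_smul {E F : Type*} [NormedAddCommGroup E]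
    [InnerProductSpace ℝ E] [NormedAddCommGroup F] [NormedSpace ℝ F] (L : E →L[ℝ] F)
    {m : ℕ} (hm : 2 ≤ m) {x : E} (hx : x ≠ 0) :
    HasFDerivAt (fun u : E => (‖u‖ ^ m)⁻¹ • L u)
      ((‖x‖ ^ m)⁻¹ • (L - (m * (‖x‖ ^ 2)⁻¹) • (innerSL ℝ x).smulRight (L x))) x := by
  refine ((hasFDerivAt_inv_norm_pow hm hx).smul L.hasFDerivAt).congr_fderiv ?_
  ext v
  simp only [add_apply, sub_apply,
    smul_apply, ContinuousLinearMap.smulRight_apply, smul_eq_mul]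
  module

/-- The field `u ↦ ‖u‖⁻ᵐ • L u` on `ℝᵐ` is right monogenic away from the origin whenever
`L` satisfies the Clifford relation `L u * L u = -‖u‖²`. -/
theorem sum_fderiv_inv_norm_pow_smul_mul_eq_zero {A : Type*} [NormedRing A] [NormedAlgebra ℝ A]
    {m : ℕ} (hm : 2 ≤ m) (L : EuclideanSpace ℝ (Fin m) →L[ℝ] A)
    (hL : ∀ u, L u * L u = algebraMap ℝ A (-‖u‖ ^ 2))
    {x : EuclideanSpace ℝ (Fin m)} (hx : x ≠ 0) :
    ∑ i : Fin m, fderiv ℝ (fun u => (‖u‖ ^ m)⁻¹ • L u) x (EuclideanSpace.single i (1 : ℝ)) *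
      L (EuclideanSpace.single i (1 : ℝ)) = 0 := by
  have hx' : ‖x‖ ≠ 0 := norm_ne_zero_iff.mpr hx
  have hsum : ∑ i : Fin m, x i • L (EuclideanSpace.single i (1 : ℝ)) = L x := by
    conv_rhs => rw [← (EuclideanSpace.basisFun (Fin m) ℝ).sum_repr x]
    simp
  have hmul : ∑ i : Fin m, L x * x i • L (EuclideanSpace.single i (1 : ℝ)) =
      algebraMap ℝ A (-‖x‖ ^ 2) := by
    rw [← Finset.mul_sum, hsum, hL]
  have hterm (i : Fin m) :
      fderiv ℝ (fun u => (‖u‖ ^ m)⁻¹ • L u) x (EuclideanSpace.single i (1 : ℝ)) *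
        L (EuclideanSpace.single i (1 : ℝ)) =
      (‖x‖ ^ m)⁻¹ • (algebraMap ℝ A (-1) -
        (m * (‖x‖ ^ 2)⁻¹) • (L x * x i • L (EuclideanSpace.single i (1 : ℝ)))) := by
    rw [(hasFDerivAt_inv_norm_pow_smul L hm hx).fderiv]
    simp [sub_mul, hL, EuclideanSpace.inner_single_right]
  simp_rw [hterm]
  rw [← Finset.smul_sum, Finset.sum_sub_distrib, ← Finset.smul_sum, hmul]
  simp only [Algebra.algebraMap_eq_smul_one, Finset.sum_const, Finset.card_univ,
    Fintype.card_fin, smul_smul, ← Nat.cast_smul_eq_nsmul ℝ, ← sub_smul]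
  convert zero_smul ℝ (1 : A) using 2
  field_simp
  ring

/-- The Clifford–Cauchy kernel `E₀(x) = -(1/σ_m) ‖x‖⁻ᵐ • ι(x)` is right monogenic away
from the origin: `∑ i ∂_{x_i} E₀(x) · ι(eᵢ) = 0` for `x ≠ 0`. Here `σ_m` is the surface
area ((m-1)-dimensional Hausdorff measure) of the unit sphere in `ℝ^m`. -/
theorem cliffordCauchyKernel_right_monogenic
    (m : ℕ) (hm : 2 ≤ m)
    (Q : QuadraticForm ℝ (EuclideanSpace ℝ (Fin m)))
    (hQ : ∀ x : EuclideanSpace ℝ (Fin m), Q x = -‖x‖ ^ 2)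
    {Cl : Type*} [NormedRing Cl] [NormedAlgebra ℝ Cl]
    (φ : CliffordAlgebra Q ≃ₐ[ℝ] Cl)
    (σm : ℝ)
    (hσm : σm = (μH[((m : ℝ) - 1)] (Metric.sphere (0 : EuclideanSpace ℝ (Fin m)) 1)).toReal)
    (E₀ : EuclideanSpace ℝ (Fin m) → Cl)
    (hE₀ : ∀ u : EuclideanSpace ℝ (Fin m),
      E₀ u = (-(σm⁻¹ * (‖u‖ ^ m)⁻¹)) • φ (CliffordAlgebra.ι Q u))
    (x : EuclideanSpace ℝ (Fin m)) (hx : x ≠ 0) :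
    (∑ i : Fin m, fderiv ℝ E₀ x (EuclideanSpace.single i (1 : ℝ)) *
        φ (CliffordAlgebra.ι Q (EuclideanSpace.single i (1 : ℝ)))) = 0 := by
  let L : EuclideanSpace ℝ (Fin m) →L[ℝ] Cl :=
    (φ.toLinearMap ∘ₗ CliffordAlgebra.ι Q).toContinuousLinearMap
  have hLφ (u) : φ (CliffordAlgebra.ι Q u) = L u := rfl
  have hL (u) : L u * L u = algebraMap ℝ Cl (-‖u‖ ^ 2) := by
    rw [← hLφ, ← map_mul, CliffordAlgebra.ι_sq_scalar, hQ, AlgEquiv.commutes]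
  have hE : E₀ = (-σm⁻¹) • fun u => (‖u‖ ^ m)⁻¹ • L u := by
    ext u
    simp [hE₀, hLφ, smul_smul]
  have hdiff := (hasFDerivAt_inv_norm_pow_smul L hm hx).differentiableAt
  simp_rw [hLφ, hE, fderiv_const_smul hdiff, smul_apply, smul_mul_assoc]
  rw [← Finset.smul_sum, sum_fderiv_inv_norm_pow_smul_mul_eq_zero hm L hL hx, smul_zero]
end

section
/- Let m ≥ 2, E = ℝ^m, Cl the real Clifford algebra of Q(x) = -‖x‖², and let σ denote the (m-1)-dimensional Hausdorff measure on ℝ^m, with σ_m = σ(unit sphere). For every x ∈ ℝ^m and R > 0, the surface integral of the Clifford–Cauchy kernel against the outward unit normal over the sphere of radius R centered at x equals the Clifford unit: ∫_{y ∈ sphere(x,R)} E_0(y - x) · ι((1/R) • (y - x)) dσ(y) = 1, where E_0(u) = -(1/σ_m) ‖u‖^{-m} • ι(u). -/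
open MeasureTheory

/-- The unit sphere of `ℝⁿ⁺¹` is covered by the radial projections of the faces of the cube
`[-1, 1]ⁿ⁺¹`. -/
theorem EuclideanSpace.sphere_subset_iUnion_image_insertNth (n : ℕ) :
    Metric.sphere (0 : EuclideanSpace ℝ (Fin (n + 1))) 1 ⊆
      ⋃ i : Fin (n + 1), ⋃ s : ℤˣ,
        (fun v : Fin n → ℝ ↦
          ‖(WithLp.toLp 2 (i.insertNth ((s : ℤ) : ℝ) v) : EuclideanSpace ℝ (Fin (n + 1)))‖⁻¹ •
          (WithLp.toLp 2 (i.insertNth ((s : ℤ) : ℝ) v) : EuclideanSpace ℝ (Fin (n + 1)))) ''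
          Metric.closedBall 0 1 := by
  intro w hw
  have hw1 : ‖w‖ = 1 := by simpa using hw
  obtain ⟨i, hi⟩ := Finite.exists_max fun j ↦ |w j|
  have hpos : 0 < |w i| := by
    rw [abs_pos]
    intro h0
    have : w = 0 := by
      ext j
      have := hi j
      simpa [h0] using this
    simp [this] at hw1
  obtain ⟨s, hs⟩ : ∃ s : ℤˣ, w i = |w i| * ((s : ℤ) : ℝ) := by
    rcases abs_choice (w i) with h | h
    · exact ⟨1, by simp [h]⟩
    · exact ⟨-1, by simp [h]⟩
  have hv : i.insertNth ((s : ℤ) : ℝ) (fun j ↦ |w i|⁻¹ * w (i.succAbove j)) =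
      fun j ↦ |w i|⁻¹ * w j := by
    ext j
    refine Fin.succAboveCases i ?_ (fun k ↦ ?_) j
    · rw [Fin.insertNth_apply_same]
      exact (eq_inv_mul_iff_mul_eq₀ hpos.ne').2 hs.symm
    · simp
  simp only [Set.mem_iUnion, Set.mem_image]
  refine ⟨i, s, fun j ↦ |w i|⁻¹ * w (i.succAbove j), ?_, ?_⟩
  · rw [mem_closedBall_zero_iff, pi_norm_le_iff_of_nonneg zero_le_one]
    intro j
    rw [norm_mul, norm_inv, Real.norm_eq_abs, Real.norm_eq_abs, abs_abs,
      inv_mul_le_iff₀ hpos, mul_one]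
    exact hi _
  · have hv' : (WithLp.toLp 2 fun j ↦ |w i|⁻¹ * w j : EuclideanSpace ℝ (Fin (n + 1))) =
        |w i|⁻¹ • w := by ext j; simp
    simp only [hv, hv', norm_smul, hw1, norm_inv, Real.norm_eq_abs, abs_abs, smul_smul]
    simp [hpos.ne']

theorem EuclideanSpace.hausdorffMeasure_sphere_lt_top (n : ℕ) :
    μH[(n : ℝ)] (Metric.sphere (0 : EuclideanSpace ℝ (Fin (n + 1))) 1) < ⊤ := by
  refine (measure_mono (sphere_subset_iUnion_image_insertNth n)).trans_lt ?_
  refine (measure_iUnion_le _).trans_lt ?_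
  rw [tsum_fintype, ENNReal.sum_lt_top]
  intro i _
  refine (measure_iUnion_le _).trans_lt ?_
  rw [tsum_fintype, ENNReal.sum_lt_top]
  intro s _
  have hg : ContDiff ℝ 1 fun v : Fin n → ℝ ↦
      (WithLp.toLp 2 (i.insertNth ((s : ℤ) : ℝ) v) : EuclideanSpace ℝ (Fin (n + 1))) := by
    rw [contDiff_euclidean]
    intro j
    refine Fin.succAboveCases i ?_ (fun k ↦ ?_) j
    · simpa using contDiff_const
    · simpa using contDiff_apply ℝ ℝ k
  have hne (v : Fin n → ℝ) :
      (WithLp.toLp 2 (i.insertNth ((s : ℤ) : ℝ) v) : EuclideanSpace ℝ (Fin (n + 1))) ≠ 0 := by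
    intro h
    have := congrArg (fun u : EuclideanSpace ℝ (Fin (n + 1)) ↦ u i) h
    simp at this
  have hf := ((hg.norm ℝ hne).inv fun v ↦ norm_ne_zero_iff.2 (hne v)).smul hg
  obtain ⟨K, hK⟩ := hf.contDiffOn.exists_lipschitzOnWith one_ne_zero
    (convex_closedBall (0 : Fin n → ℝ) 1) (isCompact_closedBall _ _)
  refine (hK.hausdorffMeasure_image_le n.cast_nonneg).trans_lt (ENNReal.mul_lt_top (by simp) ?_)
  have := hausdorffMeasure_pi_real (ι := Fin n)
  rw [Fintype.card_fin] at this
  rw [this]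
  exact measure_closedBall_lt_top

theorem EuclideanSpace.hausdorffMeasure_sphere_pos (n : ℕ) :
    0 < μH[(n : ℝ)] (Metric.sphere (0 : EuclideanSpace ℝ (Fin (n + 1))) 1) := by
  set p : EuclideanSpace ℝ (Fin (n + 1)) → Fin n → ℝ := fun w j ↦ w j.succ
  have hp : LipschitzWith 1 p := by
    refine LipschitzWith.of_dist_le_mul fun u v ↦ ?_
    rw [NNReal.coe_one, one_mul, dist_pi_le_iff dist_nonneg]
    intro j
    simpa [dist_eq_norm] using PiLp.norm_apply_le (u - v) j.succ
  set U : Set (Fin n → ℝ) := {v | ∑ j, v j ^ 2 < 1}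
  have hU : IsOpen U := isOpen_lt (by fun_prop) continuous_const
  have hsub : U ⊆ p '' Metric.sphere (0 : EuclideanSpace ℝ (Fin (n + 1))) 1 := by
    intro v hv
    have hv : ∑ j, v j ^ 2 < 1 := hv
    refine ⟨WithLp.toLp 2 (Fin.cons √(1 - ∑ j, v j ^ 2) v), ?_, ?_⟩
    · rw [mem_sphere_zero_iff_norm, EuclideanSpace.norm_eq, Real.sqrt_eq_one]
      simp [Fin.sum_univ_succ, Real.sq_sqrt (sub_nonneg.2 hv.le)]
    · ext j
      simp [p]
  have hpos : 0 < μH[(n : ℝ)] U := by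
    have := hausdorffMeasure_pi_real (ι := Fin n)
    rw [Fintype.card_fin] at this
    rw [this]
    exact hU.measure_pos _ ⟨0, by simp [U]⟩
  refine hpos.trans_le ((measure_mono hsub).trans ?_)
  simpa using (hp.lipschitzOnWith (s := Metric.sphere 0 1)).hausdorffMeasure_image_le
    n.cast_nonneg

open scoped Pointwise in
theorem EuclideanSpace.hausdorffMeasure_sphere (n : ℕ) (x : EuclideanSpace ℝ (Fin (n + 1)))
    {R : ℝ} (hR : 0 < R) :
    (μH[(n : ℝ)]).real (Metric.sphere x R) =
      R ^ n * (μH[(n : ℝ)]).real (Metric.sphere (0 : EuclideanSpace ℝ (Fin (n + 1))) 1) := by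
  have h : Metric.sphere x R =
      x +ᵥ R • Metric.sphere (0 : EuclideanSpace ℝ (Fin (n + 1))) 1 := by
    rw [smul_sphere' hR.ne', Metric.vadd_sphere]
    simp [abs_of_pos hR]
  rw [Measure.real, h, measure_vadd, Measure.hausdorffMeasure_smul₀ n.cast_nonneg hR.ne']
  simp [Measure.real, ENNReal.smul_def, abs_of_pos hR]

/-- The surface integral of the Clifford–Cauchy kernel against the outward unit normal
over any sphere `sphere(x,R)` in `ℝ^m` equals the Clifford unit:
`∫_{y ∈ sphere(x,R)} E₀(y-x) · ι((1/R) • (y-x)) dσ(y) = 1`, where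
`E₀(u) = -(1/σ_m) ‖u‖⁻ᵐ • ι(u)`, `σ = μH^{m-1}` and `σ_m = σ(unit sphere)`. -/
theorem integral_cliffordCauchyKernel_mul_normal_sphere
    (m : ℕ) (hm : 2 ≤ m)
    (Q : QuadraticForm ℝ (EuclideanSpace ℝ (Fin m)))
    (hQ : ∀ x : EuclideanSpace ℝ (Fin m), Q x = -‖x‖ ^ 2)
    {Cl : Type*} [NormedRing Cl] [NormedAlgebra ℝ Cl] [CompleteSpace Cl]
    (φ : CliffordAlgebra Q ≃ₐ[ℝ] Cl)
    (σm : ℝ)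
    (hσm : σm = (μH[((m : ℝ) - 1)] (Metric.sphere (0 : EuclideanSpace ℝ (Fin m)) 1)).toReal)
    (E₀ : EuclideanSpace ℝ (Fin m) → Cl)
    (hE₀ : ∀ u : EuclideanSpace ℝ (Fin m),
      E₀ u = (-(σm⁻¹ * (‖u‖ ^ m)⁻¹)) • φ (CliffordAlgebra.ι Q u))
    (x : EuclideanSpace ℝ (Fin m)) (R : ℝ) (hR : 0 < R) :
    (∫ y in Metric.sphere x R,
        E₀ (y - x) * φ (CliffordAlgebra.ι Q (R⁻¹ • (y - x)))
      ∂(μH[((m : ℝ) - 1)])) = 1 := by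
  obtain ⟨n, rfl⟩ : ∃ n, m = n + 1 := ⟨m - 1, by lia⟩
  have hn : ((n + 1 : ℕ) : ℝ) - 1 = n := by push_cast; ring
  rw [hn] at hσm ⊢
  have hσ : 0 < σm := hσm ▸ ENNReal.toReal_pos (EuclideanSpace.hausdorffMeasure_sphere_pos n).ne'
    (EuclideanSpace.hausdorffMeasure_sphere_lt_top n).ne
  have hconst : ∀ y ∈ Metric.sphere x R,
      E₀ (y - x) * φ (CliffordAlgebra.ι Q (R⁻¹ • (y - x))) = (σm⁻¹ * (R ^ n)⁻¹) • (1 : Cl) := by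
    intro y hy
    have hy : ‖y - x‖ = R := by rwa [mem_sphere_iff_norm] at hy
    rw [hE₀, map_smul, map_smul, smul_mul_smul_comm, ← map_mul, CliffordAlgebra.ι_sq_scalar, hQ,
      AlgEquiv.commutes, Algebra.algebraMap_eq_smul_one, smul_smul, hy]
    congr 1
    field_simp
    ring
  rw [setIntegral_congr_fun Metric.isClosed_sphere.measurableSet hconst, setIntegral_const,
    EuclideanSpace.hausdorffMeasure_sphere n x hR, Measure.real, ← hσm, smul_smul]
  have : R ^ n * σm * (σm⁻¹ * (R ^ n)⁻¹) = 1 := by field_simp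
  rw [this, one_smul]
end

section
/- Let m ≥ 3, E = ℝ^m, Cl the real Clifford algebra of Q(x) = -‖x‖², and σ = μH^{m-1} the (m-1)-dimensional Hausdorff measure. Let g : ℝ^m → Cl be continuous with ‖y‖ · ‖g(y)‖ → 0 as ‖y‖ → ∞ (along the cocompact filter). Then for every fixed x ∈ ℝ^m, ∫_{y ∈ sphere(x,R)} E_1(y - x) • ( ι((1/R) • (y - x)) · g(y) ) dσ(y) → 0 as R → ∞, where E_1(u) = (1/((m-2)σ_m)) ‖u‖^{2-m} and σ_m is the surface area of the unit sphere in ℝ^m. -/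
open MeasureTheory Filter

open scoped Pointwise in
/-- The `d`-dimensional Hausdorff measure of a sphere scales with the `d`-th power of its radius. -/
theorem hausdorffMeasure_sphere_eq_rpow_mul {E : Type*} [NormedAddCommGroup E] [NormedSpace ℝ E]
    [MeasurableSpace E] [BorelSpace E] {d : ℝ} (hd : 0 ≤ d) (x : E) {R : ℝ} (hR : 0 < R) :
    μH[d] (Metric.sphere x R) = ENNReal.ofReal (R ^ d) * μH[d] (Metric.sphere (0 : E) 1) := by
  have himage : Metric.sphere x R = IsometryEquiv.addLeft x '' (R • Metric.sphere (0 : E) 1) := by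
    rw [smul_sphere' hR.ne', IsometryEquiv.image_sphere]
    simp [abs_of_pos hR]
  rw [himage, IsometryEquiv.hausdorffMeasure_image, Measure.hausdorffMeasure_smul₀ hd hR.ne',
    ENNReal.smul_def, smul_eq_mul, ← ENNReal.ofReal_coe_nnreal]
  simp [abs_of_pos hR]

/-- If `‖y‖ * ‖g y‖ → 0` at infinity, then `R * ‖g y‖` is eventually uniformly small on the
spheres of radius `R` around a fixed centre. -/
theorem eventually_forall_mem_sphere_mul_norm_le {E F : Type*} [NormedAddCommGroup E]
    [ProperSpace E] [NormedAddCommGroup F] {g : E → F}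
    (hdecay : Tendsto (fun y => ‖y‖ * ‖g y‖) (cocompact E) (nhds 0)) (x : E) {ε : ℝ}
    (hε : 0 < ε) : ∀ᶠ R : ℝ in atTop, ∀ y ∈ Metric.sphere x R, R * ‖g y‖ ≤ ε := by
  have hsmall := hdecay.eventually_lt_const (half_pos hε)
  rw [← Metric.cobounded_eq_cocompact, hasBasis_cobounded_norm.eventually_iff] at hsmall
  obtain ⟨N, -, hN⟩ := hsmall
  filter_upwards [eventually_ge_atTop (2 * ‖x‖), eventually_ge_atTop (2 * N)] with R hRx hRN y hy
  have hy' : R ≤ ‖y‖ + ‖x‖ := by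
    rw [← mem_sphere_iff_norm.mp hy]
    exact norm_sub_le y x
  have hgy := hN (show N ≤ ‖y‖ by linarith)
  nlinarith [norm_nonneg (g y)]

/-- If `g : ℝ^m → Cl` is continuous with `‖y‖·‖g(y)‖ → 0` at infinity, then for every
fixed `x` the `E₁`-term over the large sphere vanishes:
`∫_{y ∈ sphere(x,R)} E₁(y-x) • (ι((1/R) • (y-x)) · g(y)) dσ(y) → 0` as `R → ∞`,
where `E₁(u) = (1/((m-2)σ_m)) ‖u‖^{2-m}` and `σ = μH^{m-1}`. -/
theorem tendsto_sphere_E1_term_zero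
    (m : ℕ) (hm : 3 ≤ m)
    (Q : QuadraticForm ℝ (EuclideanSpace ℝ (Fin m)))
    (hQ : ∀ x : EuclideanSpace ℝ (Fin m), Q x = -‖x‖ ^ 2)
    {Cl : Type*} [NormedRing Cl] [NormedAlgebra ℝ Cl] [CompleteSpace Cl]
    (φ : CliffordAlgebra Q ≃ₐ[ℝ] Cl)
    (σm : ℝ)
    (hσm : σm = (μH[((m : ℝ) - 1)] (Metric.sphere (0 : EuclideanSpace ℝ (Fin m)) 1)).toReal)
    (E₁ : EuclideanSpace ℝ (Fin m) → ℝ)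
    (hE₁ : ∀ u : EuclideanSpace ℝ (Fin m),
      E₁ u = (((m : ℝ) - 2) * σm)⁻¹ * (‖u‖ ^ (m - 2))⁻¹)
    (g : EuclideanSpace ℝ (Fin m) → Cl)
    (hg : Continuous g)
    (hdecay : Tendsto (fun y => ‖y‖ * ‖g y‖)
      (cocompact (EuclideanSpace ℝ (Fin m))) (nhds 0))
    (x : EuclideanSpace ℝ (Fin m)) :
    Tendsto
      (fun R : ℝ =>
        ∫ y in Metric.sphere x R,
          E₁ (y - x) • (φ (CliffordAlgebra.ι Q (R⁻¹ • (y - x))) * g y)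
        ∂(μH[((m : ℝ) - 1)]))
      atTop (nhds 0) := by
  -- If the unit sphere had infinite measure, then `σm = 0` and the kernel would vanish.
  rcases eq_or_ne σm 0 with hσ | hσ
  · simp [hE₁, hσ]
  have hfin : μH[((m : ℝ) - 1)] (Metric.sphere (0 : EuclideanSpace ℝ (Fin m)) 1) ≠ ⊤ := by
    rintro htop
    simp [hσm, htop] at hσ
  have hm' : (3 : ℝ) ≤ m := by exact_mod_cast hm
  have hσpos : 0 < σm := lt_of_le_of_ne (hσm ▸ ENNReal.toReal_nonneg) hσ.symm
  let L : EuclideanSpace ℝ (Fin m) →L[ℝ] Cl :=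
    LinearMap.toContinuousLinearMap (φ.toLinearMap ∘ₗ CliffordAlgebra.ι Q)
  rw [Metric.tendsto_nhds]
  intro ε hε
  set δ : ℝ := ε / (2 * (‖L‖ + 1)) with hδ
  have hδpos : 0 < δ := by positivity
  filter_upwards [eventually_forall_mem_sphere_mul_norm_le hdecay x hδpos,
    eventually_gt_atTop 0] with R hR hRpos
  have hmeas := hausdorffMeasure_sphere_eq_rpow_mul (d := (m : ℝ) - 1) (by linarith) x hRpos
  have hlt : μH[((m : ℝ) - 1)] (Metric.sphere x R) < ⊤ := by
    rw [hmeas]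
    exact ENNReal.mul_lt_top ENNReal.ofReal_lt_top hfin.lt_top
  have hreal : (μH[((m : ℝ) - 1)]).real (Metric.sphere x R) = R ^ (m - 1) * σm := by
    rw [Measure.real, hmeas, ENNReal.toReal_mul, ENNReal.toReal_ofReal (by positivity), ← hσm,
      ← Real.rpow_natCast, Nat.cast_sub (by omega), Nat.cast_one]
  have hbound : ∀ y ∈ Metric.sphere x R,
      ‖E₁ (y - x) • (φ (CliffordAlgebra.ι Q (R⁻¹ • (y - x))) * g y)‖ ≤
        (((m : ℝ) - 2) * σm)⁻¹ * (R ^ (m - 2))⁻¹ * (‖L‖ * (δ / R)) := by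
    intro y hy
    have hyR : ‖y - x‖ = R := mem_sphere_iff_norm.mp hy
    have hnormal : ‖φ (CliffordAlgebra.ι Q (R⁻¹ • (y - x)))‖ ≤ ‖L‖ := by
      refine L.unit_le_opNorm (R⁻¹ • (y - x)) ?_
      rw [norm_smul, hyR, norm_inv, Real.norm_of_nonneg hRpos.le, inv_mul_cancel₀ hRpos.ne']
    have hgy : ‖g y‖ ≤ δ / R := (le_div_iff₀' hRpos).mpr (hR y hy)
    have hc : 0 ≤ (((m : ℝ) - 2) * σm)⁻¹ * (R ^ (m - 2))⁻¹ := by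
      have : 0 ≤ (m : ℝ) - 2 := by linarith
      positivity
    rw [norm_smul, hE₁, hyR, Real.norm_of_nonneg hc]
    gcongr
    exact (norm_mul_le _ _).trans (by gcongr)
  rw [dist_zero_right]
  calc ‖∫ y in Metric.sphere x R,
          E₁ (y - x) • (φ (CliffordAlgebra.ι Q (R⁻¹ • (y - x))) * g y) ∂(μH[((m : ℝ) - 1)])‖
      ≤ (((m : ℝ) - 2) * σm)⁻¹ * (R ^ (m - 2))⁻¹ * (‖L‖ * (δ / R)) * (R ^ (m - 1) * σm) :=
        hreal ▸ norm_setIntegral_le_of_norm_le_const hlt hbound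
    _ = ((m : ℝ) - 2)⁻¹ * (‖L‖ * δ) := by
        have hpow : R ^ (m - 1) = R ^ (m - 2) * R := by
          rw [← pow_succ]
          congr 1
          omega
        have : (m : ℝ) - 2 ≠ 0 := by linarith
        rw [hpow]
        field_simp
    _ ≤ 1 * (‖L‖ * δ) := by
        gcongr
        exact inv_le_one_of_one_le₀ (by linarith)
    _ < ε := by
        have hmul : (‖L‖ + 1) * δ = ε / 2 := by
          rw [hδ]
          field_simp
        nlinarith
end
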